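/- Assume cov(M) = cof(M), where M denotes the σ-ideal of meager sets. Let X be a compact Polish space without isolated points and let H(X) be its homeomorphism group with the compact-open topology (a Polish group), acting naturally on X. Then there exist a subgroup H ≤ H(X) that is completely M-nonmeasurable in H(X) (with respect to the meager ideal of H(X)) and a subset A ⊆ X that is completely M-nonmeasurable in X such that HA = {h(a) : h ∈ H, a ∈ A} is completely M-nonmeasurable in X. -/

import Mathlib

open Set

/-- `cov(M)` for the σ-ideal of meager subsets of a topological space `Y`:
the least cardinality of a family of meager sets covering `Y`. -/
noncomputable def meagerCov (Y : Type) [TopologicalSpace Y] : Cardinal :=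
  sInf { c | ∃ F : Set (Set Y), (∀ B ∈ F, IsMeagre B) ∧ ⋃₀ F = Set.univ ∧
    Cardinal.mk F = c }

/-- `cof(M)` for the σ-ideal of meager subsets of a topological space `Y`:
the least cardinality of a Borel base of the meager ideal. -/
noncomputable def meagerCof (Y : Type) [TopologicalSpace Y] : Cardinal :=
  sInf { c | ∃ F : Set (Set Y), (∀ B ∈ F, IsMeagre B ∧ @MeasurableSet Y (borel Y) B) ∧
    (∀ A : Set Y, IsMeagre A → ∃ B ∈ F, A ⊆ B) ∧ Cardinal.mk F = c }

/-- `C` is completely `M`-nonmeasurable in the space `Y`: for every nonmeager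
Borel set `B`, both `B ∩ C` and `B \ C` are nonmeager. -/
def meagerComplNonmeas {Y : Type} [TopologicalSpace Y] (C : Set Y) : Prop :=
  ∀ B : Set Y, @MeasurableSet Y (borel Y) B → ¬ IsMeagre B →
    ¬ IsMeagre (B ∩ C) ∧ ¬ IsMeagre (B \ C)

variable (X : Type) [TopologicalSpace X]

/-- The homeomorphism group `H(X)` of `X`, with composition as multiplication. -/
instance homeoGroup : Group (X ≃ₜ X) where
  mul f g := g.trans f
  one := Homeomorph.refl X
  inv := Homeomorph.symm
  mul_assoc f g h := rfl
  one_mul f := rfl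
  mul_one f := rfl
  inv_mul_cancel f := Homeomorph.ext fun x => f.symm_apply_apply x

/-- The compact-open topology on the homeomorphism group `H(X)`. -/
instance homeoCompactOpen : TopologicalSpace (X ≃ₜ X) :=
  TopologicalSpace.induced
    (fun h : X ≃ₜ X => (⟨h, h.continuous_toFun⟩ : C(X, X))) ContinuousMap.compactOpen

/-! ### Transfer of meager sets between Polish spaces -/

/-- Small open sets compactly inside `V`. -/
def TrChild {Z : Type} [MetricSpace Z] (ε : ℝ) (V B : Set Z) : Prop :=
  IsOpen B ∧ B.Nonempty ∧ closure B ⊆ V ∧ ∀ x ∈ B, ∀ y ∈ B, dist x y ≤ ε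

/-- Assignments of nonempty open sets, locally constant on a dense open set. -/
def TrGood {Y Z : Type} [TopologicalSpace Y] [TopologicalSpace Z] (v : Y → Set Z) : Prop :=
  (∀ y, IsOpen (v y) ∧ (v y).Nonempty) ∧
    ∃ D : Set Y, IsOpen D ∧ Dense D ∧ ∀ y ∈ D, ∀ᶠ y' in nhds y, v y' = v y

theorem trChild_exists {Z : Type} [MetricSpace Z] {ε : ℝ} (hε : 0 < ε) {V : Set Z}
    (hV : IsOpen V) (hne : V.Nonempty) : ∃ B, TrChild ε V B := by
  obtain ⟨z, hz⟩ := hne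
  obtain ⟨r, hr, hrV⟩ := Metric.isOpen_iff.1 hV z hz
  have hs : 0 < min (r / 2) (ε / 2) := by positivity
  refine ⟨Metric.ball z (min (r / 2) (ε / 2)), Metric.isOpen_ball, ⟨z, Metric.mem_ball_self hs⟩,
    ?_, ?_⟩
  · refine Metric.closure_ball_subset_closedBall.trans (subset_trans ?_ hrV)
    apply Metric.closedBall_subset_ball
    have := min_le_left (r / 2) (ε / 2)
    linarith
  · intro x hx y hy
    have h1 := Metric.mem_ball.1 hx
    have h2 := Metric.mem_ball'.1 hy
    have h3 := dist_triangle x z y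
    have := min_le_right (r / 2) (ε / 2)
    linarith

theorem trChild_seq {Z : Type} [MetricSpace Z] [SecondCountableTopology Z] {ε : ℝ} (hε : 0 < ε)
    {V : Set Z} (hV : IsOpen V) (hne : V.Nonempty) :
    ∃ B : ℕ → Set Z, (∀ n, TrChild ε V (B n)) ∧
      ∀ O, IsOpen O → (O ∩ V).Nonempty → ∃ n, B n ⊆ O := by
  obtain ⟨b, hbc, -, hb⟩ := TopologicalSpace.exists_countable_basis Z
  have hbne : b.Nonempty := by
    obtain ⟨z, hz⟩ := hne
    obtain ⟨u, hu, -⟩ := hb.exists_subset_of_mem_open hz hV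
    exact ⟨u, hu⟩
  obtain ⟨f, rfl⟩ := hbc.exists_eq_range hbne
  have h : ∀ n, ∃ C, TrChild ε V C ∧ ((f n ∩ V).Nonempty → C ⊆ f n) := by
    intro n
    by_cases h : (f n ∩ V).Nonempty
    · obtain ⟨C, h1, h2, h3, h4⟩ := trChild_exists hε
        ((hb.isOpen (mem_range_self n)).inter hV) h
      exact ⟨C, ⟨h1, h2, h3.trans inter_subset_right, h4⟩,
        fun _ => subset_closure.trans (h3.trans inter_subset_left)⟩
    · obtain ⟨C, hC⟩ := trChild_exists hε hV hne
      exact ⟨C, hC, fun h' => absurd h' h⟩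
  choose B hB1 hB2 using h
  refine ⟨B, hB1, ?_⟩
  rintro O hO ⟨z, hzO, hzV⟩
  obtain ⟨u, ⟨n, rfl⟩, hzu, hu⟩ := hb.exists_subset_of_mem_open hzO hO
  exact ⟨n, (hB2 n ⟨z, hzu, hzV⟩).trans hu⟩

theorem tr_disjoint_seq {Y : Type} [TopologicalSpace Y] [T2Space Y]
    (hY : ∀ y : Y, ¬ IsOpen ({y} : Set Y)) {T : Set Y} (hT : IsOpen T) (hne : T.Nonempty) :
    ∃ U : ℕ → Set Y, (∀ n, (U n).Nonempty) ∧ (∀ n, IsOpen (U n)) ∧ (∀ n, U n ⊆ T) ∧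
      Pairwise (Function.onFun Disjoint U) := by
  have hinf : T.Infinite := by
    intro hfin
    obtain ⟨y, hy⟩ := hne
    apply hY y
    have h1 : IsClosed (T \ {y}) := (hfin.subset sdiff_subset).isClosed
    have : ({y} : Set Y) = T ∩ (T \ {y})ᶜ := by
      ext z
      simp only [mem_singleton_iff, mem_inter_iff, mem_compl_iff, mem_sdiff, not_and, not_not]
      constructor
      · rintro rfl
        exact ⟨hy, fun _ => rfl⟩
      · rintro ⟨h, h'⟩
        exact h' h
    rw [this]
    exact hT.inter h1.isOpen_compl
  have : Infinite T := hinf.to_subtype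
  obtain ⟨U, h1, h2, h3⟩ := exists_seq_infinite_isOpen_pairwise_disjoint T
  refine ⟨fun n => Subtype.val '' U n, fun n => (h1 n).nonempty.image _,
    fun n => hT.isOpenMap_subtype_val _ (h2 n), fun n => ?_, fun i j hij => ?_⟩
  · rintro _ ⟨x, -, rfl⟩
    exact x.2
  · exact (disjoint_image_iff Subtype.val_injective).2 (h3 hij)

theorem tr_step {Y Z : Type} [TopologicalSpace Y] [T2Space Y]
    (hY : ∀ y : Y, ¬ IsOpen ({y} : Set Y)) [MetricSpace Z] [SecondCountableTopology Z]
    {v : Y → Set Z} (hv : TrGood v) {T : Set Y} (hT : IsOpen T) (hne : T.Nonempty)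
    {ε : ℝ} (hε : 0 < ε) :
    ∃ v' : Y → Set Z, TrGood v' ∧ (∀ y, TrChild ε (v y) (v' y)) ∧
      ∃ y₀ ∈ T, ∀ O, IsOpen O → (O ∩ v y₀).Nonempty →
        ∃ y₁ ∈ T, v' y₁ ⊆ O ∧ ∀ᶠ y' in nhds y₁, v' y' = v' y₁ := by
  classical
  obtain ⟨hv1, D, hDo, hDd, hD⟩ := hv
  obtain ⟨y₀, hy₀T, hy₀D⟩ := hDd.inter_open_nonempty T hT hne
  obtain ⟨N, hN, hNo, hyN⟩ := eventually_nhds_iff.1 (hD y₀ hy₀D)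
  obtain ⟨W, hW1, hW2, hW3, hW4⟩ := tr_disjoint_seq hY (hNo.inter hT) ⟨y₀, hyN, hy₀T⟩
  obtain ⟨B, hB1, hB2⟩ := trChild_seq hε (hv1 y₀).1 (hv1 y₀).2
  choose c hc using fun y => trChild_exists hε (hv1 y).1 (hv1 y).2
  -- the default child depends on the value only
  choose d hd using fun V : {V : Set Z // IsOpen V ∧ V.Nonempty} =>
    trChild_exists hε V.2.1 V.2.2
  let v' : Y → Set Z := fun y =>
    if h : ∃ n, y ∈ W n then B h.choose else d ⟨v y, hv1 y⟩
  have hvW : ∀ n, ∀ y ∈ W n, v' y = B n := by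
    intro n y hy
    have h : ∃ n, y ∈ W n := ⟨n, hy⟩
    have : h.choose = n := by
      by_contra hne
      exact (Set.disjoint_left.1 (hW4 hne) h.choose_spec) hy
    simp only [v', dif_pos h, this]
  have hvn : ∀ y, (¬ ∃ n, y ∈ W n) → v' y = d ⟨v y, hv1 y⟩ := fun y h => by
    simp only [v', dif_neg h]
  have hch : ∀ y, TrChild ε (v y) (v' y) := by
    intro y
    by_cases h : ∃ n, y ∈ W n
    · obtain ⟨n, hn⟩ := h
      rw [hvW n y hn, hN y (hW3 n hn).1]
      exact hB1 n
    · rw [hvn y h]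
      exact hd ⟨v y, hv1 y⟩
  have hloc : ∀ n, ∀ y ∈ W n, ∀ᶠ y' in nhds y, v' y' = v' y := by
    intro n y hy
    filter_upwards [(hW2 n).mem_nhds hy] with y' hy'
    rw [hvW n y hy, hvW n y' hy']
  refine ⟨v', ⟨fun y => ⟨(hch y).1, (hch y).2.1⟩, (⋃ n, W n) ∪ (D \ closure (⋃ n, W n)), ?_, ?_, ?_⟩,
    hch, y₀, hy₀T, ?_⟩
  · exact (isOpen_iUnion hW2).union (hDo.sdiff isClosed_closure)
  · rw [dense_iff_inter_open]
    intro S hS hSne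
    by_cases h : (S ∩ ⋃ n, W n).Nonempty
    · obtain ⟨y, hy1, hy2⟩ := h
      exact ⟨y, hy1, Or.inl hy2⟩
    · obtain ⟨y, hyS, hyD⟩ := hDd.inter_open_nonempty S hS hSne
      refine ⟨y, hyS, Or.inr ⟨hyD, fun hcl => h ?_⟩⟩
      exact mem_closure_iff.1 hcl S hS hyS
  · rintro y (hy | ⟨hyD, hy⟩)
    · obtain ⟨n, hn⟩ := mem_iUnion.1 hy
      exact hloc n y hn
    · filter_upwards [hD y hyD, isClosed_closure.isOpen_compl.mem_nhds hy] with y' h1 h2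
      have e1 : ¬ ∃ n, y ∈ W n := fun ⟨n, hn⟩ => hy (subset_closure (mem_iUnion.2 ⟨n, hn⟩))
      have e2 : ¬ ∃ n, y' ∈ W n := fun ⟨n, hn⟩ => h2 (subset_closure (mem_iUnion.2 ⟨n, hn⟩))
      rw [hvn y e1, hvn y' e2]
      congr 1
      exact Subtype.ext h1
  · intro O hO hOne
    obtain ⟨n, hn⟩ := hB2 O hO hOne
    obtain ⟨y₁, hy₁⟩ := hW1 n
    exact ⟨y₁, (hW3 n hy₁).2, by rwa [hvW n y₁ hy₁], hloc n y₁ hy₁⟩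

theorem tr_nowhereDense {Y : Type} [TopologicalSpace Y] {S : Set Y}
    (h : ∀ T : Set Y, IsOpen T → T.Nonempty → ∃ T' ⊆ T, IsOpen T' ∧ T'.Nonempty ∧ Disjoint T' S) :
    IsNowhereDense S := by
  by_contra hne
  obtain ⟨T', hT', ho, ⟨y, hy⟩, hd⟩ := h _ isOpen_interior (nonempty_iff_ne_empty.2 hne)
  obtain ⟨z, hz1, hz2⟩ := mem_closure_iff.1 (interior_subset (hT' hy)) T' ho hy
  exact disjoint_left.1 hd hz1 hz2

theorem tr_transfer {Y Z : Type} [TopologicalSpace Y] [T2Space Y] [SecondCountableTopology Y]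
    (hY : ∀ y : Y, ¬ IsOpen ({y} : Set Y)) [TopologicalSpace Z] [PolishSpace Z]
    {U : Set Z} (hU : IsOpen U) (hUne : U.Nonempty) :
    ∃ φ : Y → Z, (∀ y, φ y ∈ U) ∧ ∀ M : Set Z, IsMeagre M → IsMeagre (φ ⁻¹' M) := by
  letI := TopologicalSpace.upgradeIsCompletelyMetrizable Z
  rcases isEmpty_or_nonempty Y with hE | hYne
  · refine ⟨fun y => hE.elim y, fun y => hE.elim y, fun M _ => ?_⟩
    rw [Set.eq_empty_of_isEmpty (_ ⁻¹' M)]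
    exact IsMeagre.empty
  obtain ⟨b, hbc, hb0, hb⟩ := TopologicalSpace.exists_countable_basis Y
  have hbne : b.Nonempty := by
    obtain ⟨y⟩ := hYne
    obtain ⟨u, hu, -⟩ := hb.exists_subset_of_mem_open (mem_univ y) isOpen_univ
    exact ⟨u, hu⟩
  obtain ⟨T, rfl⟩ := hbc.exists_eq_range hbne
  have hTo : ∀ n, IsOpen (T n) := fun n => hb.isOpen (mem_range_self n)
  have hTne : ∀ n, (T n).Nonempty := fun n => by
    rw [nonempty_iff_ne_empty]
    intro h
    exact hb0 ⟨n, h⟩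
  have hε : ∀ n : ℕ, (0 : ℝ) < 1 / ((n : ℝ) + 1) := fun n => by positivity
  choose F hF1 hF2 hF3 using fun (n : ℕ) (v : {v : Y → Set Z // TrGood v}) =>
    tr_step hY v.2 (hTo n) (hTne n) (hε n)
  have h0 : TrGood (fun _ : Y => U) :=
    ⟨fun _ => ⟨hU, hUne⟩, univ, isOpen_univ, dense_univ, fun y _ => Filter.Eventually.of_forall
      fun _ => rfl⟩
  let w : ℕ → {v : Y → Set Z // TrGood v} := fun n =>
    Nat.rec ⟨_, h0⟩ (fun n v => ⟨F n v, hF1 n v⟩) n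
  let v : ℕ → Y → Set Z := fun n => (w n).1
  have hv1 : ∀ (n : ℕ) (y : Y), TrChild (1 / ((n : ℝ) + 1)) (v n y) (v (n + 1) y) := fun n y => hF2 n (w n) y
  have hv3 : ∀ n, ∃ y₀ ∈ T n, ∀ O, IsOpen O → (O ∩ v n y₀).Nonempty →
        ∃ y₁ ∈ T n, v (n + 1) y₁ ⊆ O ∧ ∀ᶠ y' in nhds y₁, v (n + 1) y' = v (n + 1) y₁ :=
    fun n => hF3 n (w n)
  have hanti : ∀ y, Antitone (fun n => v n y) := fun y =>
    antitone_nat_of_succ_le fun n => subset_closure.trans (hv1 n y).2.2.1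
  have hpt : ∀ y, ∃ z, ∀ n, z ∈ v n y := by
    intro y
    choose x hx using fun n => (hv1 n y).2.1
    have hc : CauchySeq x := by
      refine cauchySeq_of_le_tendsto_0 (fun n : ℕ => 1 / ((n : ℝ) + 1)) ?_
        tendsto_one_div_add_atTop_nhds_zero_nat
      intro n m N hn hm
      exact (hv1 N y).2.2.2 _ (hanti y (by lia : N + 1 ≤ n + 1) (hx n)) _
        (hanti y (by lia : N + 1 ≤ m + 1) (hx m))
    obtain ⟨z, hz⟩ := cauchySeq_tendsto_of_complete hc
    refine ⟨z, fun n => (hv1 n y).2.2.1 ?_⟩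
    refine mem_closure_of_tendsto hz ?_
    filter_upwards [Filter.eventually_ge_atTop n] with m hm
    exact hanti y (by lia : n + 1 ≤ m + 1) (hx m)
  choose φ hφ using hpt
  refine ⟨φ, fun y => hφ y 0, fun M hM => ?_⟩
  have key : ∀ t : Set Z, IsNowhereDense t → IsNowhereDense (φ ⁻¹' t) := by
    intro t ht
    refine tr_nowhereDense fun S hS hSne => ?_
    obtain ⟨s, hs⟩ := hSne
    obtain ⟨_, ⟨n, rfl⟩, -, hn⟩ := hb.exists_subset_of_mem_open hs hS
    obtain ⟨y₀, -, h⟩ := hv3 n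
    have hdense : Dense (closure t)ᶜ := by
      rw [← interior_eq_empty_iff_dense_compl]
      exact ht
    obtain ⟨y₁, hy₁, hsub, hev⟩ := h _ isClosed_closure.isOpen_compl (by
      rw [inter_comm]
      exact hdense.inter_open_nonempty _ ((w n).2.1 y₀).1 ((w n).2.1 y₀).2)
    obtain ⟨N, hN, hNo, hyN⟩ := eventually_nhds_iff.1 hev
    refine ⟨N ∩ T n, inter_subset_right.trans hn, hNo.inter (hTo n), ⟨y₁, hyN, hy₁⟩, ?_⟩
    rw [disjoint_left]
    rintro y ⟨hyN', -⟩ hyt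
    have h1 := hφ y (n + 1)
    rw [hN y hyN'] at h1
    exact hsub h1 (subset_closure hyt)
  rw [isMeagre_iff_countable_union_isNowhereDense] at hM ⊢
  obtain ⟨S, hS1, hS2, hS3⟩ := hM
  refine ⟨(fun t => φ ⁻¹' t) '' S, ?_, hS2.image _, ?_⟩
  · rintro _ ⟨t, ht, rfl⟩
    exact key t (hS1 t ht)
  · intro y hy
    obtain ⟨t, ht, hyt⟩ := hS3 hy
    exact ⟨_, ⟨t, ht, rfl⟩, hyt⟩

/-! ### Transfinite construction -/

theorem trans_construct {ι T : Type} [LinearOrder ι] [WellFoundedLT ι]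
    (Good : Set T → Prop) (R : ι → T → Prop) (h0 : Good ∅)
    (hdir : ∀ C : Set (Set T), C.Nonempty → DirectedOn (· ⊆ ·) C → (∀ S ∈ C, Good S) → Good (⋃₀ C))
    (hstep : ∀ (i : ι) (S : Set T), Good S → Cardinal.mk S ≤ Cardinal.mk (Iio i) →
      ∃ x, R i x ∧ Good (insert x S)) [Nonempty T] :
    ∃ f : ι → T, (∀ i, R i (f i)) ∧ Good (range f) := by
  classical
  let P : (i : ι) → Set T → T → Prop := fun i S x => R i x ∧ Good (insert x S)
  let F : (i : ι) → ((j : ι) → j < i → T) → T := fun i g =>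
    Classical.epsilon (P i {x | ∃ j, ∃ h : j < i, g j h = x})
  let f : ι → T := (wellFounded_lt (α := ι)).fix F
  have hf : ∀ i, f i = Classical.epsilon (P i (f '' Iio i)) := by
    intro i
    have h1 : f i = F i (fun j _ => f j) := (wellFounded_lt (α := ι)).fix_eq F i
    rw [h1]
    simp only [F]
    congr 2
    ext x
    simp [image]
  have himg : ∀ i, f '' Iic i = insert (f i) (f '' Iio i) := by
    intro i
    rw [← image_insert_eq, Iio_insert]
  have hchain : ∀ s : Set ι, (∀ i ∈ s, Good (f '' Iic i)) →
      Good (⋃₀ ((fun i => f '' Iic i) '' s)) := by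
    intro s hs
    rcases s.eq_empty_or_nonempty with rfl | hne
    · simpa using h0
    · refine hdir _ (hne.image _) ?_ ?_
      · rintro _ ⟨i, hi, rfl⟩ _ ⟨j, hj, rfl⟩
        rcases le_total i j with h | h
        · exact ⟨_, ⟨j, hj, rfl⟩, image_mono (Iic_subset_Iic.2 h), subset_rfl⟩
        · exact ⟨_, ⟨i, hi, rfl⟩, subset_rfl, image_mono (Iic_subset_Iic.2 h)⟩
      · rintro _ ⟨i, hi, rfl⟩
        exact hs i hi
  have main : ∀ i, R i (f i) ∧ Good (f '' Iic i) := by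
    intro i
    induction i using WellFoundedLT.induction with
    | ind i ih =>
      have hg : Good (f '' Iio i) := by
        have := hchain (Iio i) (fun j hj => (ih j hj).2)
        convert this using 1
        ext x
        constructor
        · rintro ⟨j, hj, rfl⟩
          exact ⟨_, ⟨j, hj, rfl⟩, j, le_rfl, rfl⟩
        · rintro ⟨_, ⟨j, hj, rfl⟩, k, hk, rfl⟩
          exact ⟨k, lt_of_le_of_lt hk hj, rfl⟩
      have := Classical.epsilon_spec (hstep i _ hg Cardinal.mk_image_le)
      rw [himg, hf i]
      exact this
  refine ⟨f, fun i => (main i).1, ?_⟩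
  have := hchain univ (fun j _ => (main j).2)
  convert this using 1
  ext x
  constructor
  · rintro ⟨j, rfl⟩
    exact ⟨_, ⟨j, mem_univ _, rfl⟩, j, le_rfl, rfl⟩
  · rintro ⟨_, ⟨j, hj, rfl⟩, k, hk, rfl⟩
    exact ⟨k, rfl⟩

theorem mk_subgroup_closure_le {G : Type} [Group G] (s : Set G) :
    Cardinal.mk (Subgroup.closure s) ≤ max (Cardinal.mk s) Cardinal.aleph0 := by
  rcases isEmpty_or_nonempty s with h | h
  · have : s = ∅ := Set.isEmpty_coe_sort.1 h
    subst this
    rw [Subgroup.closure_empty]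
    exact le_max_of_le_right (Cardinal.mk_le_aleph0)
  · rw [FreeGroup.closure_eq_range, ← Cardinal.mk_freeGroup]
    exact Cardinal.mk_range_le (f := FreeGroup.lift ((↑) : s → G))

/-! ### Cardinal coefficients -/

theorem meagre_subset_borel {Y : Type} [TopologicalSpace Y] {A : Set Y} (hA : IsMeagre A) :
    ∃ B, A ⊆ B ∧ IsMeagre B ∧ @MeasurableSet Y (borel Y) B := by
  borelize Y
  rw [isMeagre_iff_countable_union_isNowhereDense] at hA
  obtain ⟨S, hS1, hS2, hS3⟩ := hA
  refine ⟨⋃ t ∈ S, closure t, ?_, ?_, ?_⟩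
  · intro x hx
    obtain ⟨t, ht, hxt⟩ := hS3 hx
    exact mem_biUnion ht (subset_closure hxt)
  · refine isMeagre_biUnion hS2 fun t ht => IsNowhereDense.isMeagre ?_
    have := hS1 t ht
    unfold IsNowhereDense at this ⊢
    rwa [closure_closure]
  · exact MeasurableSet.biUnion hS2 fun t _ => isClosed_closure.measurableSet

theorem meagerCof_attained (Y : Type) [TopologicalSpace Y] :
    ∃ F : Set (Set Y), (∀ B ∈ F, IsMeagre B) ∧
      (∀ A : Set Y, IsMeagre A → ∃ B ∈ F, A ⊆ B) ∧ Cardinal.mk F = meagerCof Y := by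
  have hne : { c | ∃ F : Set (Set Y), (∀ B ∈ F, IsMeagre B ∧ @MeasurableSet Y (borel Y) B) ∧
    (∀ A : Set Y, IsMeagre A → ∃ B ∈ F, A ⊆ B) ∧ Cardinal.mk F = c }.Nonempty := by
    refine ⟨_, {B | IsMeagre B ∧ @MeasurableSet Y (borel Y) B}, fun B hB => hB, fun A hA => ?_, rfl⟩
    obtain ⟨B, h1, h2⟩ := meagre_subset_borel hA
    exact ⟨B, h2, h1⟩
  obtain ⟨F, h1, h2, h3⟩ := csInf_mem hne
  exact ⟨F, fun B hB => (h1 B hB).1, h2, h3⟩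

theorem meagerCov_le {Y J : Type} [TopologicalSpace Y] (N : J → Set Y) (hN : ∀ j, IsMeagre (N j))
    (hcov : ∀ y, ∃ j, y ∈ N j) : meagerCov Y ≤ Cardinal.mk J := by
  refine le_trans (csInf_le' ⟨range N, ?_, ?_, rfl⟩) Cardinal.mk_range_le
  · rintro _ ⟨j, rfl⟩
    exact hN j
  · ext y
    obtain ⟨j, hj⟩ := hcov y
    simp only [mem_univ, iff_true]
    exact ⟨_, ⟨j, rfl⟩, hj⟩

theorem exists_avoid {Y Z J : Type} [TopologicalSpace Y] [T2Space Y] [SecondCountableTopology Y]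
    (hY : ∀ y : Y, ¬ IsOpen ({y} : Set Y)) [TopologicalSpace Z] [PolishSpace Z]
    {U : Set Z} (hU : IsOpen U) (hUne : U.Nonempty) (N : J → Set Z) (hN : ∀ j, IsMeagre (N j))
    (hJ : Cardinal.mk J < meagerCov Y) : ∃ z ∈ U, ∀ j, z ∉ N j := by
  obtain ⟨φ, h1, h2⟩ := tr_transfer hY hU hUne
  by_contra! hcon
  exact absurd hJ (not_lt.2 (meagerCov_le (fun j => φ ⁻¹' N j) (fun j => h2 _ (hN j))
    (fun y => hcon _ (h1 y))))

theorem isMeagre_singleton' {Y : Type} [TopologicalSpace Y] [T1Space Y]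
    (hY : ∀ y : Y, ¬ IsOpen ({y} : Set Y)) (y : Y) : IsMeagre ({y} : Set Y) := by
  refine IsNowhereDense.isMeagre ?_
  unfold IsNowhereDense
  rw [closure_singleton]
  by_contra hne
  rcases subset_singleton_iff_eq.1 (interior_subset (s := ({y} : Set Y))) with h | h
  · exact hne h
  · exact hY y (by rw [← h]; exact isOpen_interior)

theorem aleph0_lt_cof {Y : Type} [TopologicalSpace Y] [T1Space Y] [BaireSpace Y] [Nonempty Y]
    (hY : ∀ y : Y, ¬ IsOpen ({y} : Set Y)) : Cardinal.aleph0 < meagerCof Y := by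
  obtain ⟨F, h1, h2, h3⟩ := meagerCof_attained Y
  by_contra! hle
  rw [← h3, Cardinal.le_aleph0_iff_set_countable] at hle
  refine not_isMeagre_of_isOpen isOpen_univ (univ_nonempty (α := Y)) ?_
  refine (isMeagre_biUnion hle (f := id) h1).mono fun y _ => ?_
  obtain ⟨B, hB, hyB⟩ := h2 _ (isMeagre_singleton' hY y)
  exact mem_biUnion hB (hyB rfl)

/-- A space with `cov(M) = cof(M)` and at least one isolated point in a homogeneous
situation is excluded: if all points are isolated, the equality fails. -/
theorem cov_ne_cof_of_discrete (Y : Type) [TopologicalSpace Y]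
    (hd : ∀ y : Y, IsOpen ({y} : Set Y)) : meagerCov Y ≠ meagerCof Y := by
  have hdt : DiscreteTopology Y := discreteTopology_iff_isOpen_singleton.2 hd
  have hcov : meagerCov Y = 0 := by
    rcases isEmpty_or_nonempty Y with hE | hne
    · have := meagerCov_le (Y := Y) (J := Empty) (fun j => j.elim) (fun j => j.elim)
        (fun y => hE.elim y)
      simpa using this
    · have : { c | ∃ F : Set (Set Y), (∀ B ∈ F, IsMeagre B) ∧ ⋃₀ F = Set.univ ∧
          Cardinal.mk F = c } = ∅ := by
        rw [eq_empty_iff_forall_notMem]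
        rintro c ⟨F, hF, hU, -⟩
        obtain ⟨y⟩ := hne
        obtain ⟨B, hB, hyB⟩ : y ∈ ⋃₀ F := by rw [hU]; trivial
        exact not_isMeagre_of_isOpen (isOpen_discrete B) ⟨y, hyB⟩ (hF B hB)
      unfold meagerCov
      rw [this, Cardinal.sInf_empty]
  obtain ⟨F, h1, h2, h3⟩ := meagerCof_attained Y
  rw [hcov, ← h3]
  intro h
  obtain ⟨B, hB, -⟩ := h2 ∅ IsMeagre.empty
  have := Cardinal.mk_eq_zero_iff.1 h.symm
  exact this.elim ⟨B, hB⟩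

theorem complNonmeas_of_open {Y : Type} [TopologicalSpace Y] {C : Set Y}
    (h : ∀ U : Set Y, IsOpen U → U.Nonempty → ¬ IsMeagre (U ∩ C) ∧ ¬ IsMeagre (U \ C)) :
    meagerComplNonmeas C := by
  intro B hB hBm
  borelize Y
  obtain ⟨U, hU, hBU⟩ := hB.residualEq_isOpen
  have hdiff : IsMeagre (U \ B) := by
    unfold IsMeagre
    filter_upwards [hBU] with x hx
    have : (x ∈ B) = (x ∈ U) := hx
    simp [this]
  have hdiff' : IsMeagre (B \ U) := by
    unfold IsMeagre
    filter_upwards [hBU] with x hx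
    have : (x ∈ B) = (x ∈ U) := hx
    simp [this]
  have hne : U.Nonempty := by
    rw [nonempty_iff_ne_empty]
    rintro rfl
    simp at hdiff'
    exact hBm hdiff'
  obtain ⟨h1, h2⟩ := h U hU hne
  constructor
  · intro hm
    refine h1 ((hm.union hdiff).mono ?_)
    rintro x ⟨hxU, hxC⟩
    by_cases hx : x ∈ B
    · exact Or.inl ⟨hx, hxC⟩
    · exact Or.inr ⟨hxU, hx⟩
  · intro hm
    refine h2 ((hm.union hdiff).mono ?_)
    rintro x ⟨hxU, hxC⟩
    by_cases hx : x ∈ B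
    · exact Or.inl ⟨hx, hxC⟩
    · exact Or.inr ⟨hxU, hx⟩

/-! ### Words over a subgroup -/

/-- Words with one free variable and coefficients in `Γ`, as functions. -/
def wordGroup {G : Type} [Group G] (Γ : Subgroup G) : Subgroup (G → G) :=
  Subgroup.closure (insert id ((fun g : G => (fun _ : G => g)) '' (Γ : Set G)))

theorem wordGroup_continuous {G : Type} [Group G] [TopologicalSpace G] [IsTopologicalGroup G]
    {Γ : Subgroup G} {f : G → G} (hf : f ∈ wordGroup Γ) : Continuous f := by
  induction hf using Subgroup.closure_induction with
  | mem f hf =>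
    rcases hf with rfl | ⟨g, -, rfl⟩
    · exact continuous_id
    · exact continuous_const
  | one => exact continuous_const
  | mul f g _ _ hf hg => exact hf.mul hg
  | inv f _ hf => exact hf.inv

theorem wordGroup_apply_mem {G : Type} [Group G] {Γ : Subgroup G} {f : G → G}
    (hf : f ∈ wordGroup Γ) {h : G} (hh : h ∈ Γ) : f h ∈ Γ := by
  induction hf using Subgroup.closure_induction with
  | mem f hf =>
    rcases hf with rfl | ⟨g, hg, rfl⟩
    · exact hh
    · exact hg
  | one => exact Γ.one_mem
  | mul f g _ _ hf hg => exact Γ.mul_mem hf hg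
  | inv f _ hf => exact Γ.inv_mem hf

theorem wordGroup_surj {G : Type} [Group G] {Γ : Subgroup G} {h g : G}
    (hg : g ∈ Subgroup.closure (insert h (Γ : Set G))) : ∃ f ∈ wordGroup Γ, f h = g := by
  induction hg using Subgroup.closure_induction with
  | mem g hg =>
    rcases hg with rfl | hg
    · exact ⟨id, Subgroup.subset_closure (Or.inl rfl), rfl⟩
    · exact ⟨fun _ => g, Subgroup.subset_closure (Or.inr ⟨g, hg, rfl⟩), rfl⟩
  | one => exact ⟨1, Subgroup.one_mem _, rfl⟩
  | mul a b _ _ ha hb =>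
    obtain ⟨f, hf, rfl⟩ := ha
    obtain ⟨f', hf', rfl⟩ := hb
    exact ⟨f * f', Subgroup.mul_mem _ hf hf', rfl⟩
  | inv a _ ha =>
    obtain ⟨f, hf, rfl⟩ := ha
    exact ⟨f⁻¹, Subgroup.inv_mem _ hf, rfl⟩

theorem mk_wordGroup_lt {G : Type} [Group G] {Γ : Subgroup G} {κ : Cardinal}
    (hκ : Cardinal.aleph0 < κ) (hΓ : Cardinal.mk Γ < κ) : Cardinal.mk (wordGroup Γ) < κ := by
  refine (mk_subgroup_closure_le _).trans_lt (max_lt ?_ hκ)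
  refine Cardinal.mk_insert_le.trans_lt (Cardinal.add_lt_of_lt hκ.le ?_
    (Cardinal.one_lt_aleph0.trans hκ))
  exact Cardinal.mk_image_le.trans_lt hΓ

theorem meagre_eq_of_dense {G Z : Type} [TopologicalSpace G] [TopologicalSpace Z] [T1Space Z]
    {Γ : Set G} (hΓ : Dense Γ) {f : G → Z} (hf : Continuous f) {z : Z}
    (h : ∀ g ∈ Γ, f g ≠ z) : IsMeagre {g | f g = z} := by
  have hc : IsClosed {g | f g = z} := isClosed_singleton.preimage hf
  refine IsNowhereDense.isMeagre ?_
  unfold IsNowhereDense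
  rw [hc.closure_eq, interior_eq_empty_iff_dense_compl]
  exact hΓ.mono fun g hg => h g hg

/-! ### The abstract theorem -/

section abstractMain

variable {G P : Type} [Group G] [TopologicalSpace G] [TopologicalSpace P] [MulAction G P]

/-- Group generated by the base set and the first coordinates. -/
def genGroup (H₀ : Set G) (S : Set (G × P × P)) : Subgroup G :=
  Subgroup.closure (H₀ ∪ Prod.fst '' S)

/-- The invariant of the construction. -/
def GoodSet (H₀ : Set G) (e : G) (S : Set (G × P × P)) : Prop :=
  e ∉ genGroup H₀ S ∧ ∀ p ∈ S, ∀ q ∈ S, ∀ g ∈ genGroup H₀ S, g • p.2.1 ≠ q.2.2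

theorem genGroup_mono {H₀ : Set G} {S S' : Set (G × P × P)} (h : S ⊆ S') :
    genGroup H₀ S ≤ genGroup H₀ S' :=
  Subgroup.closure_mono (union_subset_union_right _ (image_mono h))

theorem genGroup_directed {H₀ : Set G} {C : Set (Set (G × P × P))} (hne : C.Nonempty)
    (hC : DirectedOn (· ⊆ ·) C) {g : G} (hg : g ∈ genGroup H₀ (⋃₀ C)) :
    ∃ S ∈ C, g ∈ genGroup H₀ S := by
  induction hg using Subgroup.closure_induction with
  | mem g hg =>
    rcases hg with hg | ⟨p, ⟨S, hS, hp⟩, rfl⟩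
    · obtain ⟨S, hS⟩ := hne
      exact ⟨S, hS, Subgroup.subset_closure (Or.inl hg)⟩
    · exact ⟨S, hS, Subgroup.subset_closure (Or.inr ⟨p, hp, rfl⟩)⟩
  | one =>
    obtain ⟨S, hS⟩ := hne
    exact ⟨S, hS, Subgroup.one_mem _⟩
  | mul a b _ _ ha hb =>
    obtain ⟨S, hS, ha⟩ := ha
    obtain ⟨S', hS', hb⟩ := hb
    obtain ⟨S'', hS'', h1, h2⟩ := hC S hS S' hS'
    exact ⟨S'', hS'', Subgroup.mul_mem _ (genGroup_mono h1 ha) (genGroup_mono h2 hb)⟩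
  | inv a _ ha =>
    obtain ⟨S, hS, ha⟩ := ha
    exact ⟨S, hS, Subgroup.inv_mem _ ha⟩

theorem goodSet_directed {H₀ : Set G} {e : G} {C : Set (Set (G × P × P))} (hne : C.Nonempty)
    (hC : DirectedOn (· ⊆ ·) C) (h : ∀ S ∈ C, GoodSet H₀ e S) : GoodSet H₀ e (⋃₀ C) := by
  constructor
  · intro he
    obtain ⟨S, hS, he⟩ := genGroup_directed hne hC he
    exact (h S hS).1 he
  · rintro p ⟨S₁, hS₁, hp⟩ q ⟨S₂, hS₂, hq⟩ g hg
    obtain ⟨S₃, hS₃, hg⟩ := genGroup_directed hne hC hg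
    obtain ⟨S₄, hS₄, h1, h2⟩ := hC _ hS₁ _ hS₂
    obtain ⟨S₅, hS₅, h3, h4⟩ := hC _ hS₃ _ hS₄
    exact (h S₅ hS₅).2 p (h4 (h1 hp)) q (h4 (h2 hq)) g (genGroup_mono h3 hg)

theorem mk_genGroup_lt {H₀ : Set G} {S : Set (G × P × P)} {κ : Cardinal}
    (hκ : Cardinal.aleph0 < κ) (hH : H₀.Countable) (hS : Cardinal.mk S < κ) :
    Cardinal.mk (genGroup H₀ S) < κ := by
  refine (mk_subgroup_closure_le _).trans_lt (max_lt ?_ hκ)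
  refine (Cardinal.mk_union_le _ _).trans_lt (Cardinal.add_lt_of_lt hκ.le ?_ ?_)
  · exact (Cardinal.le_aleph0_iff_set_countable.2 hH).trans_lt hκ
  · exact Cardinal.mk_image_le.trans_lt hS

theorem good_step [IsTopologicalGroup G] [PolishSpace G] [PolishSpace P]
    (hact : ∀ x : P, Continuous fun g : G => g • x)
    (hP : ∀ x : P, ¬ IsOpen ({x} : Set P)) (hκ : Cardinal.aleph0 < meagerCov P)
    {H₀ : Set G} (hHc : H₀.Countable) (hHd : Dense H₀) {e : G} {S : Set (G × P × P)}
    (hS : GoodSet H₀ e S) (hSc : Cardinal.mk S < meagerCov P)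
    {M : Set G} (hM : IsMeagre M) {N U : Set P} (hN : IsMeagre N) (hU : IsOpen U)
    (hUne : U.Nonempty) :
    ∃ x : G × P × P, (x.1 ∉ M ∧ (x.2.1 ∈ U ∧ x.2.1 ∉ N) ∧ (x.2.2 ∈ U ∧ x.2.2 ∉ N)) ∧
      GoodSet H₀ e (insert x S) := by
  have h1κ : (1 : Cardinal) < meagerCov P := Cardinal.one_lt_aleph0.trans hκ
  have hopt : ∀ J : Type, Cardinal.mk J < meagerCov P → Cardinal.mk (Option J) < meagerCov P := by
    intro J hJ
    rw [Cardinal.mk_option]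
    exact Cardinal.add_lt_of_lt hκ.le hJ h1κ
  have hprod : ∀ J J' : Type, Cardinal.mk J < meagerCov P → Cardinal.mk J' < meagerCov P →
      Cardinal.mk (J × J') < meagerCov P := by
    intro J J' hJ hJ'
    rw [Cardinal.mk_prod, Cardinal.lift_id, Cardinal.lift_id]
    exact Cardinal.mul_lt_of_lt hκ.le hJ hJ'
  have hΓd : Dense (genGroup H₀ S : Set G) :=
    hHd.mono fun g hg => Subgroup.subset_closure (Or.inl hg)
  -- choose `h`
  obtain ⟨h, -, hh⟩ := exists_avoid hP (Z := G) isOpen_univ ⟨1, trivial⟩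
    (J := Option (wordGroup (genGroup H₀ S) × Option (S × S)))
    (fun j => match j with
      | none => M
      | some (f, none) => {g | f.1 g = e}
      | some (f, some (p, q)) => {g | f.1 g • p.1.2.1 = q.1.2.2})
    (fun j => match j with
      | none => hM
      | some (f, none) => meagre_eq_of_dense hΓd (wordGroup_continuous f.2)
          (fun g hg hge => hS.1 (hge ▸ wordGroup_apply_mem f.2 hg))
      | some (f, some (p, q)) => meagre_eq_of_dense hΓd
          ((hact p.1.2.1).comp (wordGroup_continuous f.2))
          (fun g hg => hS.2 p.1 p.2 q.1 q.2 _ (wordGroup_apply_mem f.2 hg)))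
    (hopt _ (hprod _ _ (mk_wordGroup_lt hκ (mk_genGroup_lt hκ hHc hSc))
      (hopt _ (hprod _ _ hSc hSc))))
  let Γ : Subgroup G := Subgroup.closure (insert h (genGroup H₀ S : Set G))
  have hΓc : Cardinal.mk Γ < meagerCov P := by
    refine (mk_subgroup_closure_le _).trans_lt (max_lt ?_ hκ)
    exact Cardinal.mk_insert_le.trans_lt (Cardinal.add_lt_of_lt hκ.le (mk_genGroup_lt hκ hHc hSc) h1κ)
  -- choose `a`
  obtain ⟨a, haU, ha⟩ := exists_avoid hP hU hUne (J := Option (Γ × S))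
    (fun j => match j with
      | none => N
      | some (g, q) => {g.1⁻¹ • q.1.2.2})
    (fun j => match j with
      | none => hN
      | some (g, q) => isMeagre_singleton' hP _)
    (hopt _ (hprod _ _ hΓc hSc))
  -- choose `d`
  obtain ⟨d, hdU, hd⟩ := exists_avoid hP hU hUne (J := Option (Γ × Option S))
    (fun j => match j with
      | none => N
      | some (g, none) => {g.1 • a}
      | some (g, some p) => {g.1 • p.1.2.1})
    (fun j => match j with
      | none => hN
      | some (g, none) => isMeagre_singleton' hP _
      | some (g, some p) => isMeagre_singleton' hP _)
    (hopt _ (hprod _ _ hΓc (hopt _ hSc)))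
  refine ⟨(h, a, d), ⟨hh none, ⟨haU, ha none⟩, hdU, hd none⟩, ?_⟩
  have hle : genGroup H₀ (insert (h, a, d) S) ≤ Γ := by
    refine (Subgroup.closure_le _).2 ?_
    rintro g (hg | ⟨p, rfl | hp, rfl⟩)
    · exact Subgroup.subset_closure (Or.inr (Subgroup.subset_closure (Or.inl hg)))
    · exact Subgroup.subset_closure (Or.inl rfl)
    · exact Subgroup.subset_closure (Or.inr (Subgroup.subset_closure (Or.inr ⟨p, hp, rfl⟩)))
  constructor
  · intro he
    obtain ⟨f, hf, hfe⟩ := wordGroup_surj (hle he)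
    exact hh (some (⟨f, hf⟩, none)) hfe
  · rintro p hp q hq g hg heq
    have hgΓ := hle hg
    rcases hp with rfl | hp
    · rcases hq with rfl | hq
      · exact hd (some (⟨g, hgΓ⟩, none)) heq.symm
      · refine ha (some (⟨g, hgΓ⟩, ⟨q, hq⟩)) ?_
        exact eq_inv_smul_iff.2 heq
    · rcases hq with rfl | hq
      · exact hd (some (⟨g, hgΓ⟩, some ⟨p, hp⟩)) heq.symm
      · obtain ⟨f, hf, rfl⟩ := wordGroup_surj hgΓ
        exact hh (some (⟨f, hf⟩, some (⟨p, hp⟩, ⟨q, hq⟩))) heq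

theorem subgroup_complNonmeas [IsTopologicalGroup G] {H₀ : Set G} (hHc : H₀.Countable)
    (hHd : Dense H₀) {H : Subgroup G} (hH : H₀ ⊆ H) (hm : ¬ IsMeagre (H : Set G)) {e : G}
    (he : e ∉ H) : meagerComplNonmeas (H : Set G) := by
  have key : ∀ U : Set G, IsOpen U → U.Nonempty → ¬ IsMeagre (U ∩ H) := by
    intro U hU ⟨u, hu⟩ hmU
    refine hm (IsMeagre.mono (s := ⋃ g ∈ H₀, (fun k => g * k) ⁻¹' (U ∩ H)) ?_ ?_)
    · intro k hk
      have ho : IsOpen ((fun g => g * k) ⁻¹' U) := hU.preimage (continuous_mul_const k)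
      obtain ⟨g, hgU, hg⟩ := hHd.inter_open_nonempty _ ho ⟨u * k⁻¹, by simpa using hu⟩
      exact mem_biUnion hg ⟨hgU, H.mul_mem (hH hg) hk⟩
    · refine isMeagre_biUnion hHc fun g _ => ?_
      exact hmU.preimage_of_isOpenMap (continuous_const_mul g) (isOpenMap_mul_left g)
  refine complNonmeas_of_open fun U hU hUne => ⟨key U hU hUne, fun hmU => ?_⟩
  obtain ⟨u, hu⟩ := hUne
  refine key ((fun k => e * k) ⁻¹' U) (hU.preimage (continuous_const_mul e))
    ⟨e⁻¹ * u, by simpa using hu⟩ ?_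
  refine (hmU.preimage_of_isOpenMap (continuous_const_mul e) (isOpenMap_mul_left e)).mono ?_
  rintro k ⟨hk, hkH⟩
  refine ⟨hk, fun hek => he ?_⟩
  have := H.mul_mem hek (H.inv_mem hkH)
  simpa using this

theorem abstract_main [IsTopologicalGroup G] [PolishSpace G] [PolishSpace P] [Nonempty P]
    (hact : ∀ x : P, Continuous fun g : G => g • x)
    (hP : ∀ x : P, ¬ IsOpen ({x} : Set P)) (hG : ∀ x : G, ¬ IsOpen ({x} : Set G))
    (hcP : meagerCov P = meagerCof P) (hcG : meagerCov G = meagerCof G) :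
    ∃ H : Subgroup G, meagerComplNonmeas (H : Set G) ∧
      ∃ A : Set P, meagerComplNonmeas A ∧
        meagerComplNonmeas {y : P | ∃ h ∈ H, ∃ a ∈ A, h • a = y} := by
  have hκ : Cardinal.aleph0 < meagerCov P := by
    rw [hcP]
    exact aleph0_lt_cof hP
  obtain ⟨FP, hFP1, hFP2, hFP3⟩ := meagerCof_attained P
  obtain ⟨FG, hFG1, hFG2, hFG3⟩ := meagerCof_attained G
  rw [← hcP] at hFP3
  have hGle : Cardinal.mk FG ≤ meagerCov P := by
    rw [hFG3, ← hcG, ← hFP3]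
    obtain ⟨φ, -, hφ⟩ := tr_transfer hG (Z := P) isOpen_univ univ_nonempty
    refine meagerCov_le (fun B : FP => φ ⁻¹' B.1) (fun B => hφ _ (hFP1 _ B.2)) fun y => ?_
    obtain ⟨B, hB, hyB⟩ := hFP2 _ (isMeagre_singleton' hP (φ y))
    exact ⟨⟨B, hB⟩, hyB rfl⟩
  obtain ⟨b, hbc, hb0, hb⟩ := TopologicalSpace.exists_countable_basis P
  obtain ⟨H₀, hHc, hHd⟩ := TopologicalSpace.exists_countable_dense G
  -- an element outside the base group
  obtain ⟨e, he⟩ : ∃ e : G, e ∉ genGroup (P := P) H₀ ∅ := by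
    by_contra! hall
    have hc : (genGroup (P := P) H₀ ∅ : Set G).Countable := by
      rw [← Cardinal.le_aleph0_iff_set_countable]
      refine (mk_subgroup_closure_le _).trans (max_le ?_ le_rfl)
      rw [image_empty, union_empty]
      exact Cardinal.le_aleph0_iff_set_countable.2 hHc
    refine not_isMeagre_of_isOpen isOpen_univ (univ_nonempty (α := G)) ?_
    refine (isMeagre_biUnion hc (f := fun g => {g}) fun g _ => isMeagre_singleton' hG g).mono ?_
    intro g _
    exact mem_biUnion (hall g) rfl
  -- the index set
  let ι : Type := (meagerCov P).ord.ToType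
  have hι : Cardinal.mk ι = meagerCov P := Cardinal.mk_ord_toType _
  have hIio : ∀ i : ι, Cardinal.mk (Iio i) < meagerCov P := by
    intro i
    have := Cardinal.mk_Iio_lt i (by simp [ι])
    rwa [hι] at this
  have hcard : Cardinal.mk (FP × FG × b) ≤ Cardinal.mk ι := by
    rw [hι]
    simp only [Cardinal.mk_prod, Cardinal.lift_id]
    refine (mul_le_mul' hFP3.le (mul_le_mul' hGle
      ((Cardinal.le_aleph0_iff_set_countable.2 hbc).trans hκ.le))).trans ?_
    rw [Cardinal.mul_eq_self hκ.le, Cardinal.mul_eq_self hκ.le]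
  obtain ⟨emb⟩ := hcard
  have hbne : b.Nonempty := by
    obtain ⟨x⟩ := ‹Nonempty P›
    obtain ⟨u, hu, -⟩ := hb.exists_subset_of_mem_open (mem_univ x) isOpen_univ
    exact ⟨u, hu⟩
  have hinh : Nonempty (FP × FG × b) := by
    obtain ⟨B, hB, -⟩ := hFP2 ∅ IsMeagre.empty
    obtain ⟨B', hB', -⟩ := hFG2 ∅ IsMeagre.empty
    obtain ⟨u, hu⟩ := hbne
    exact ⟨⟨B, hB⟩, ⟨B', hB'⟩, ⟨u, hu⟩⟩
  have hsurj := Function.invFun_surjective emb.injective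
  set en : ι → FP × FG × b := Function.invFun emb
  have hb' : ∀ u : b, u.1.Nonempty := by
    rintro ⟨u, hu⟩
    rw [nonempty_iff_ne_empty]
    rintro rfl
    exact hb0 hu
  obtain ⟨f, hfR, hfG⟩ := trans_construct (ι := ι) (T := G × P × P) (GoodSet H₀ e)
    (fun i x => x.1 ∉ (en i).2.1.1 ∧ (x.2.1 ∈ (en i).2.2.1 ∧ x.2.1 ∉ (en i).1.1) ∧
      (x.2.2 ∈ (en i).2.2.1 ∧ x.2.2 ∉ (en i).1.1))
    ⟨he, fun p hp => absurd hp (notMem_empty p)⟩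
    (fun C hne hC h => goodSet_directed hne hC h)
    (fun i S hS hSc => good_step hact hP hκ hHc hHd hS (hSc.trans_lt (hIio i))
      (hFG1 _ (en i).2.1.2) (hFP1 _ (en i).1.2) (hb.isOpen (en i).2.2.2) (hb' _))
  let H : Subgroup G := genGroup H₀ (range f)
  have hHm : ¬ IsMeagre (H : Set G) := by
    intro hm
    obtain ⟨M, hM, hHM⟩ := hFG2 _ hm
    obtain ⟨i, hi⟩ := hsurj (hinh.some.1, ⟨M, hM⟩, hinh.some.2.2)
    have h1 := (hfR i).1
    rw [hi] at h1
    exact h1 (hHM (Subgroup.subset_closure (Or.inr ⟨f i, mem_range_self i, rfl⟩)))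
  let A : Set P := {y | ∃ h ∈ H, ∃ i, h • (f i).2.1 = y}
  have hA : meagerComplNonmeas A := by
    refine complNonmeas_of_open fun U hU hUne => ?_
    obtain ⟨x, hx⟩ := hUne
    obtain ⟨u, hu, -, huU⟩ := hb.exists_subset_of_mem_open hx hU
    constructor
    · intro hm
      obtain ⟨N, hN, hmN⟩ := hFP2 _ hm
      obtain ⟨i, hi⟩ := hsurj (⟨N, hN⟩, hinh.some.2.1, ⟨u, hu⟩)
      have h1 := (hfR i).2.1
      rw [hi] at h1
      exact h1.2 (hmN ⟨huU h1.1, 1, H.one_mem, i, one_smul _ _⟩)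
    · intro hm
      obtain ⟨N, hN, hmN⟩ := hFP2 _ hm
      obtain ⟨i, hi⟩ := hsurj (⟨N, hN⟩, hinh.some.2.1, ⟨u, hu⟩)
      have h1 := (hfR i).2.2
      rw [hi] at h1
      refine h1.2 (hmN ⟨huU h1.1, ?_⟩)
      rintro ⟨g, hg, j, hj⟩
      exact hfG.2 _ (mem_range_self j) _ (mem_range_self i) g hg hj
  refine ⟨H, subgroup_complNonmeas hHc hHd (fun g hg => Subgroup.subset_closure (Or.inl hg)) hHm
    hfG.1, A, hA, ?_⟩
  convert hA using 1
  ext y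
  constructor
  · rintro ⟨h, hh, a, ⟨g, hg, i, rfl⟩, rfl⟩
    exact ⟨h * g, H.mul_mem hh hg, i, mul_smul _ _ _⟩
  · intro hy
    exact ⟨1, H.one_mem, y, hy, one_smul _ _⟩

end abstractMain

/-! ### The homeomorphism group -/

section homeo

variable {K : Type} [TopologicalSpace K]

/-- The inclusion of `H(K)` into `C(K, K)`. -/
def homeoToC (h : K ≃ₜ K) : C(K, K) := ⟨h, h.continuous_toFun⟩

theorem homeoToC_inducing : Topology.IsInducing (homeoToC (K := K)) := ⟨rfl⟩

theorem homeo_continuous_inv [CompactSpace K] [T2Space K] :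
    Continuous fun h : K ≃ₜ K => homeoToC h.symm := by
  rw [ContinuousMap.continuous_compactOpen]
  intro C hC O hO
  have h1 : IsOpen {f : C(K, K) | MapsTo f Oᶜ Cᶜ} :=
    ContinuousMap.isOpen_setOfPred_mapsTo hO.isClosed_compl.isCompact hC.isClosed.isOpen_compl
  convert h1.preimage homeoToC_inducing.continuous using 1
  ext h
  constructor
  · intro hm x hx hxC
    apply hx
    have := hm hxC
    simpa [homeoToC] using this
  · intro hm x hx
    by_contra hxO
    exact hm hxO (by simpa [homeoToC] using hx)

instance homeo_isTopologicalGroup [CompactSpace K] [T2Space K] :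
    IsTopologicalGroup (K ≃ₜ K) where
  continuous_mul := by
    rw [homeoToC_inducing.continuous_iff]
    exact (homeoToC_inducing.continuous.comp continuous_fst).compCM
      (homeoToC_inducing.continuous.comp continuous_snd)
  continuous_inv := by
    rw [homeoToC_inducing.continuous_iff]
    exact homeo_continuous_inv

theorem homeo_polish [CompactSpace K] [PolishSpace K] : PolishSpace (K ≃ₜ K) := by
  let := TopologicalSpace.upgradeIsCompletelyMetrizable K
  have hC : PolishSpace C(K, K) := inferInstance
  have hemb : Topology.IsClosedEmbedding
      (fun h : K ≃ₜ K => (homeoToC h, homeoToC h.symm)) := by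
    refine ⟨⟨?_, ?_⟩, ?_⟩
    · refine Topology.IsInducing.of_comp (homeoToC_inducing.continuous.prodMk homeo_continuous_inv)
        continuous_fst homeoToC_inducing
    · intro h h' hh
      ext x
      exact DFunLike.congr_fun (congrArg Prod.fst hh) x
    · have : range (fun h : K ≃ₜ K => (homeoToC h, homeoToC h.symm)) =
          {p : C(K, K) × C(K, K) | p.1.comp p.2 = ContinuousMap.id K} ∩
          {p : C(K, K) × C(K, K) | p.2.comp p.1 = ContinuousMap.id K} := by
        ext ⟨f, g⟩
        constructor
        · rintro ⟨h, hh⟩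
          obtain ⟨rfl, rfl⟩ := Prod.ext_iff.1 hh
          constructor
          · ext x
            simp [homeoToC]
          · ext x
            simp [homeoToC]
        · rintro ⟨h1, h2⟩
          exact ⟨⟨⟨f, g, fun x => DFunLike.congr_fun h2 x, fun x => DFunLike.congr_fun h1 x⟩,
            f.continuous, g.continuous⟩, rfl⟩
      rw [this]
      exact (isClosed_eq (continuous_fst.compCM continuous_snd) continuous_const).inter
        (isClosed_eq (continuous_snd.compCM continuous_fst) continuous_const)
  exact hemb.polishSpace

/-- The natural action of `H(K)` on `K`. -/
@[reducible] def homeoAction : MulAction (K ≃ₜ K) K where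
  smul h x := h x
  one_smul _ := rfl
  mul_smul _ _ _ := rfl

end homeo

theorem statement11 (X : Type) [TopologicalSpace X] [PolishSpace X] [CompactSpace X]
    -- `X` has no isolated points
    (hniso : ∀ x : X, ¬ IsOpen ({x} : Set X))
    -- `cov(M) = cof(M)` (the coefficients of the meager ideal do not depend on the
    -- underlying perfect Polish space; we state the assumption for the two spaces
    -- involved, `X` and `H(X)`)
    (hX : meagerCov X = meagerCof X)
    (hHX : meagerCov (X ≃ₜ X) = meagerCof (X ≃ₜ X)) :
    ∃ H : Subgroup (X ≃ₜ X),
      meagerComplNonmeas (H : Set (X ≃ₜ X)) ∧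
      ∃ A : Set X, meagerComplNonmeas A ∧
        meagerComplNonmeas {y : X | ∃ h ∈ H, ∃ a ∈ A, h a = y} := by
  have hPol : PolishSpace (X ≃ₜ X) := homeo_polish
  have hne : Nonempty X := by
    by_contra hE
    exact cov_ne_cof_of_discrete X (fun x => (hE ⟨x⟩).elim) hX
  have hG : ∀ g : X ≃ₜ X, ¬ IsOpen ({g} : Set (X ≃ₜ X)) := by
    intro g hg
    refine cov_ne_cof_of_discrete (X ≃ₜ X) (fun k => ?_) hHX
    have := hg.preimage (continuous_const_mul (g * k⁻¹))
    convert this using 1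
    ext x
    simp only [mem_singleton_iff, mem_preimage]
    constructor
    · rintro rfl
      group
    · intro h
      have h' : g * (k⁻¹ * x) = g * 1 := by rw [← mul_assoc, h, mul_one]
      exact (inv_mul_eq_one.1 (mul_left_cancel h')).symm
  let := homeoAction (K := X)
  exact abstract_main (G := X ≃ₜ X) (P := X)
    (fun x => (continuous_eval_const (F := C(X, X)) x).comp homeoToC_inducing.continuous)
    hniso hG hX hHX
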